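/- arXiv:1508.04353 — 2 statements merged into one kernel-verified Lean document; each statement's English description precedes it below -/
import Mathlib

section
/- Let k be an algebraically closed field and A a spectroid over k. If f : L → M is an irreducible monomorphism in mod A and the canonical cokernel morphism M → coker(f) is also irreducible, then coker(f) is finitely presented. -/
open CategoryTheory CategoryTheory.Limits

namespace Paper

variable (k : Type) [Field k]

section General

variable (A : Type) [Category.{0} A] [Preadditive A] [CategoryTheory.Linear k A]

/-- A spectroid over `k`: a (small) Hom-finite `k`-linear category in which every object
has a local endomorphism ring and distinct objects are not isomorphic. -/
class Spectroid : Prop where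
  homFinite : ∀ a b : A, FiniteDimensional k (a ⟶ b)
  localEnd : ∀ a : A, IsLocalRing (End a)
  skeletal : ∀ a b : A, (a ≅ b) → a = b

variable {A}

/-- `M` is a module over `A`, i.e. the functor `M : A ⥤ ModuleCat k` is additive and
`k`-linear on morphisms. -/
def IsMod (M : A ⥤ ModuleCat.{0} k) : Prop :=
  (∀ {a b : A} (f g : a ⟶ b), M.map (f + g) = M.map f + M.map g) ∧
  (∀ {a b : A} (r : k) (f : a ⟶ b), M.map (r • f) = r • M.map f)

/-- `M` is a locally finite dimensional module over `A`, i.e. an object of `mod A`. -/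
def IsLfdMod (M : A ⥤ ModuleCat.{0} k) : Prop :=
  IsMod k M ∧ ∀ a : A, FiniteDimensional k (M.obj a)

/-- The projective module `P_a = Hom_A(a, -)` at an object `a`. -/
noncomputable def ProjAt (a : A) : A ⥤ ModuleCat.{0} k :=
  (linearCoyoneda k A).obj (Opposite.op a)

/-- The injective module `I_a = D Hom_A(-, a)` at an object `a`. -/
noncomputable def InjAt (a : A) : A ⥤ ModuleCat.{0} k where
  obj b := ModuleCat.of k (Module.Dual k (b ⟶ a))
  map {b c} f := ModuleCat.ofHom (LinearMap.dualMap (Linear.leftComp k a f))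
  map_id b := by
    have h : Linear.leftComp k a (𝟙 b) = LinearMap.id := by
      apply LinearMap.ext; intro g; simp
    rw [h, LinearMap.dualMap_id]; rfl
  map_comp {b c d} f g := by
    have h : Linear.leftComp k a (f ≫ g) =
        (Linear.leftComp k a f).comp (Linear.leftComp k a g) := by
      apply LinearMap.ext; intro h; simp
    rw [h]; rfl

instance : HasFiniteBiproducts (A ⥤ ModuleCat.{0} k) :=
  CategoryTheory.Abelian.hasFiniteBiproducts

/-- `M` is finitely generated: there is an epimorphism `⊕_{i=1}^r P_{a_i} → M`. -/
def IsFG (M : A ⥤ ModuleCat.{0} k) : Prop :=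
  ∃ (r : ℕ) (a : Fin r → A) (f : (⨁ fun i => ProjAt k (a i)) ⟶ M), Epi f

/-- `M` is finitely presented: there is an epimorphism `⊕_{i=1}^r P_{a_i} → M` with
finitely generated kernel. -/
def IsFP (M : A ⥤ ModuleCat.{0} k) : Prop :=
  ∃ (r : ℕ) (a : Fin r → A) (f : (⨁ fun i => ProjAt k (a i)) ⟶ M),
    Epi f ∧ IsFG k (kernel f)

/-- `M` is finitely co-generated: there is a monomorphism `M → ⊕_{j=1}^s I_{b_j}`. -/
def IsFCG (M : A ⥤ ModuleCat.{0} k) : Prop :=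
  ∃ (s : ℕ) (b : Fin s → A) (f : M ⟶ ⨁ fun j => InjAt k (b j)), Mono f

/-- `M` is finitely co-presented: there is a monomorphism `M → ⊕_{j=1}^s I_{b_j}` with
finitely co-generated cokernel. -/
def IsFCP (M : A ⥤ ModuleCat.{0} k) : Prop :=
  ∃ (s : ℕ) (b : Fin s → A) (f : M ⟶ ⨁ fun j => InjAt k (b j)),
    Mono f ∧ IsFCG k (cokernel f)

/-- `f` is an irreducible morphism in `mod A`: it is neither a split mono nor a split epi,
and in any factorization `f = g ≫ h` through an object of `mod A`, `g` is a split mono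
or `h` is a split epi. -/
def Irred {L M : A ⥤ ModuleCat.{0} k} (f : L ⟶ M) : Prop :=
  ¬ IsSplitMono f ∧ ¬ IsSplitEpi f ∧
    ∀ ⦃X : A ⥤ ModuleCat.{0} k⦄, IsLfdMod k X →
      ∀ (g : L ⟶ X) (h : X ⟶ M), g ≫ h = f → IsSplitMono g ∨ IsSplitEpi h

/-- `M` is an indecomposable object of `mod A`: it is nonzero, and whenever `M ≅ X ⊞ Y`
with `X`, `Y` in `mod A`, one of `X`, `Y` is zero. -/
def Indec (M : A ⥤ ModuleCat.{0} k) : Prop :=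
  ¬ IsZero M ∧ ∀ ⦃X Y : A ⥤ ModuleCat.{0} k⦄, IsLfdMod k X → IsLfdMod k Y →
    (M ≅ X ⊞ Y) → IsZero X ∨ IsZero Y

/-- `0 → L →f M →g N → 0` is an almost split sequence in `mod A`. -/
structure AlmostSplitSeq {L M N : A ⥤ ModuleCat.{0} k} (f : L ⟶ M) (g : M ⟶ N) : Prop where
  mono : Mono f
  epi : Epi g
  zero : f ≫ g = 0
  exact : (ShortComplex.mk f g zero).Exact
  not_splitMono : ¬ IsSplitMono f
  not_splitEpi : ¬ IsSplitEpi g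
  left_almost_split : ∀ ⦃X : A ⥤ ModuleCat.{0} k⦄, IsLfdMod k X →
    ∀ u : L ⟶ X, ¬ IsSplitMono u → ∃ v : M ⟶ X, f ≫ v = u
  right_almost_split : ∀ ⦃X : A ⥤ ModuleCat.{0} k⦄, IsLfdMod k X →
    ∀ u : X ⟶ N, ¬ IsSplitEpi u → ∃ v : X ⟶ M, v ≫ g = u

/-- `M` is projective as an object of `mod A`. -/
def ProjInMod (M : A ⥤ ModuleCat.{0} k) : Prop :=
  ∀ ⦃X Y : A ⥤ ModuleCat.{0} k⦄, IsLfdMod k X → IsLfdMod k Y →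
    ∀ (e : X ⟶ Y), Epi e → ∀ u : M ⟶ Y, ∃ t : M ⟶ X, t ≫ e = u

/-- `M` is injective as an object of `mod A`. -/
def InjInMod (M : A ⥤ ModuleCat.{0} k) : Prop :=
  ∀ ⦃X Y : A ⥤ ModuleCat.{0} k⦄, IsLfdMod k X → IsLfdMod k Y →
    ∀ (m : X ⟶ Y), Mono m → ∀ u : X ⟶ M, ∃ t : Y ⟶ M, m ≫ t = u

/-- `h` is a (nonempty) composition of irreducible morphisms between indecomposable
objects of `mod A`. -/
inductive IrredChain : ∀ {X Y : A ⥤ ModuleCat.{0} k}, (X ⟶ Y) → Prop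
  | single {X Y : A ⥤ ModuleCat.{0} k} (f : X ⟶ Y) :
      IsLfdMod k X → Indec k X → IsLfdMod k Y → Indec k Y → Irred k f → IrredChain f
  | comp {X Y Z : A ⥤ ModuleCat.{0} k} (f : X ⟶ Y) (g : Y ⟶ Z) :
      IsLfdMod k X → Indec k X → Irred k f → IrredChain g → IrredChain (f ≫ g)

end General

section QuiverSection

variable (Q : Type) [Quiver.{0} Q]

/-- `Q` is locally finite: every vertex is the source of finitely many arrows and the
target of finitely many arrows. -/
def LocallyFinite : Prop :=
  ∀ x : Q, Finite (Σ y : Q, x ⟶ y) ∧ Finite (Σ y : Q, y ⟶ x)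

/-- `Q` is interval finite: there are finitely many paths between any two vertices. -/
def IntervalFinite : Prop :=
  ∀ x y : Q, Finite (Quiver.Path x y)

/-- `Q` is strongly locally finite: locally finite and interval finite. -/
def StronglyLocallyFinite : Prop :=
  LocallyFinite Q ∧ IntervalFinite Q

/-- `Q` is connected: nonempty, and any two vertices are joined by a walk. -/
def QuiverConnected : Prop :=
  Nonempty Q ∧ ∀ x y : Q,
    Nonempty (Quiver.Path (Quiver.Symmetrify.of.obj x) (Quiver.Symmetrify.of.obj y))

/-- The path category `kQ` of the quiver `Q`: the free `k`-linear category on the free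
category on `Q`. -/
abbrev PathCat := CategoryTheory.Free k (Paths Q)

/-- A vertex of `Q`, seen as an object of the path category `kQ`. -/
noncomputable def vtx (x : Q) : PathCat k Q :=
  (Free.embedding k (Paths Q)).obj ((Paths.of Q).obj x)

/-- An arrow of `Q`, seen as a morphism of the path category `kQ`. -/
noncomputable def arrHom {x y : Q} (α : x ⟶ y) : vtx k Q x ⟶ vtx k Q y :=
  (Free.embedding k (Paths Q)).map ((Paths.of Q).map α)

/-- The degree of a vertex of `Q`: the total number of arrows incident to it. -/
noncomputable def degree (x : Q) : ℕ :=
  Nat.card ((Σ y : Q, x ⟶ y) ⊕ (Σ y : Q, y ⟶ x))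

/-- `M` belongs to `rrep(Q)`: it is the middle term of a short exact sequence
`0 → L → M → N → 0` with `L` finitely presented, `N` finitely co-presented, and only
finitely many arrows `α` of `Q` satisfy `M(α) ≠ 0`, `L(α) = 0` and `N(α) = 0`. -/
def InRrep (M : PathCat k Q ⥤ ModuleCat.{0} k) : Prop :=
  ∃ (L N : PathCat k Q ⥤ ModuleCat.{0} k) (f : L ⟶ M) (g : M ⟶ N) (zero : f ≫ g = 0),
    Mono f ∧ Epi g ∧ (ShortComplex.mk f g zero).Exact ∧ IsFP k L ∧ IsFCP k N ∧
    Set.Finite {p : Σ (x : Q) (y : Q), x ⟶ y |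
      M.map (arrHom k Q p.2.2) ≠ 0 ∧ L.map (arrHom k Q p.2.2) = 0 ∧
      N.map (arrHom k Q p.2.2) = 0}

variable {Q}

/-- The vertices occurring in a path. -/
def InPath {x : Q} : ∀ {y : Q}, Quiver.Path x y → Q → Prop
  | _, Quiver.Path.nil, v => v = x
  | _, @Quiver.Path.cons _ _ _ _ c p _, v => v = c ∨ InPath p v

variable (Q)

/-- `Q` is a star quiver: it is obtained from a finite full convex subquiver `Γ` by
attaching finitely many rays and co-rays with no common vertices. -/
def IsStarQuiver : Prop :=
  ∃ (Γ S₁ S₂ : Set Q) (v : Q → ℕ → Q),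
    Γ.Finite ∧ S₁ ⊆ Γ ∧ S₂ ⊆ Γ ∧ Disjoint S₁ S₂ ∧
    (∀ x y : Q, x ∈ Γ → y ∈ Γ → ∀ p : Quiver.Path x y, ∀ z : Q, InPath p z → z ∈ Γ) ∧
    (∀ s ∈ S₁ ∪ S₂, ∀ i : ℕ, v s i ∉ Γ) ∧
    (∀ s ∈ S₁ ∪ S₂, ∀ t ∈ S₁ ∪ S₂, ∀ i j : ℕ, v s i = v t j → s = t ∧ i = j) ∧
    (∀ x : Q, x ∉ Γ → ∃ s ∈ S₁ ∪ S₂, ∃ i : ℕ, x = v s i) ∧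
    (∀ s ∈ S₁, Nat.card (s ⟶ v s 0) = 1 ∧ ∀ i : ℕ, Nat.card (v s i ⟶ v s (i + 1)) = 1) ∧
    (∀ s ∈ S₂, Nat.card (v s 0 ⟶ s) = 1 ∧ ∀ i : ℕ, Nat.card (v s (i + 1) ⟶ v s i) = 1) ∧
    (∀ x y : Q, (x ⟶ y) → ¬(x ∈ Γ ∧ y ∈ Γ) →
      (∃ s ∈ S₁, (x = s ∧ y = v s 0) ∨ ∃ i : ℕ, x = v s i ∧ y = v s (i + 1)) ∨
      (∃ s ∈ S₂, (x = v s 0 ∧ y = s) ∨ ∃ i : ℕ, x = v s (i + 1) ∧ y = v s i))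

end QuiverSection

section Functors

variable {k} {A : Type} [Category.{0} A]

lemma app_map_apply {X Y : A ⥤ ModuleCat.{0} k} (η : X ⟶ Y) {a b : A} (φ : a ⟶ b)
    (x : X.obj a) :
    (η.app b).hom ((X.map φ).hom x) = (Y.map φ).hom ((η.app a).hom x) := by
  have h := η.naturality φ
  exact congrArg (fun g => g.hom x) h

lemma map_comp_apply' (X : A ⥤ ModuleCat.{0} k) {a b c : A} (φ : a ⟶ b) (ψ : b ⟶ c)
    (x : X.obj a) :
    (X.map (φ ≫ ψ)).hom x = (X.map ψ).hom ((X.map φ).hom x) := by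
  rw [X.map_comp]; rfl

lemma natTrans_ext_apply {X Y : A ⥤ ModuleCat.{0} k} {η θ : X ⟶ Y}
    (h : ∀ a (x : X.obj a), (η.app a).hom x = (θ.app a).hom x) : η = θ := by
  ext a x
  exact h a x

lemma epi_iff_app_surjective {X Y : A ⥤ ModuleCat.{0} k} (η : X ⟶ Y) :
    Epi η ↔ ∀ a, Function.Surjective (η.app a).hom := by
  rw [NatTrans.epi_iff_epi_app]
  exact forall_congr' fun a => ModuleCat.epi_iff_surjective _

lemma mono_iff_app_injective {X Y : A ⥤ ModuleCat.{0} k} (η : X ⟶ Y) :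
    Mono η ↔ ∀ a, Function.Injective (η.app a).hom := by
  rw [NatTrans.mono_iff_mono_app]
  exact forall_congr' fun a => ModuleCat.mono_iff_injective _

/-- The value at `b` of the submodule of `X` generated by a set `T` of elements of `X`. -/
def genAt (X : A ⥤ ModuleCat.{0} k) (T : Set (Σ a : A, X.obj a)) (b : A) :
    Submodule k (X.obj b) :=
  Submodule.span k {z | ∃ s ∈ T, ∃ φ : s.1 ⟶ b, (X.map φ).hom s.2 = z}

lemma map_mem_genAt {X : A ⥤ ModuleCat.{0} k} {T : Set (Σ a : A, X.obj a)}
    {s : Σ a : A, X.obj a} (hs : s ∈ T) {b : A} (φ : s.1 ⟶ b) :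
    (X.map φ).hom s.2 ∈ genAt X T b :=
  Submodule.subset_span ⟨s, hs, φ, rfl⟩

lemma mem_genAt {X : A ⥤ ModuleCat.{0} k} {T : Set (Σ a : A, X.obj a)}
    {s : Σ a : A, X.obj a} (hs : s ∈ T) : s.2 ∈ genAt X T s.1 := by
  simpa using map_mem_genAt hs (𝟙 _)

lemma genAt_map (X : A ⥤ ModuleCat.{0} k) (T : Set (Σ a : A, X.obj a)) {a b : A} (φ : a ⟶ b) :
    genAt X T a ≤ (genAt X T b).comap (X.map φ).hom := by
  refine Submodule.span_le.2 ?_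
  rintro _ ⟨s, hs, ψ, rfl⟩
  change (X.map φ).hom ((X.map ψ).hom s.2) ∈ genAt X T b
  rw [← map_comp_apply']
  exact map_mem_genAt hs _

lemma genAt_le_ker {X Y : A ⥤ ModuleCat.{0} k} (η : X ⟶ Y) {T : Set (Σ a : A, X.obj a)}
    (h : ∀ s ∈ T, (η.app s.1).hom s.2 = 0) (b : A) :
    genAt X T b ≤ LinearMap.ker (η.app b).hom := by
  refine Submodule.span_le.2 ?_
  rintro _ ⟨s, hs, φ, rfl⟩
  simp [h s hs]

/-- The quotient of `X` by the submodule generated by a set `T` of elements. -/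
noncomputable def quotGen (X : A ⥤ ModuleCat.{0} k) (T : Set (Σ a : A, X.obj a)) :
    A ⥤ ModuleCat.{0} k where
  obj b := ModuleCat.of k (X.obj b ⧸ genAt X T b)
  map φ := ModuleCat.ofHom ((genAt X T _).mapQ (genAt X T _) (X.map φ).hom (genAt_map X T φ))
  map_id b := by
    ext x
    simp
  map_comp φ ψ := by
    ext x
    simp

/-- The projection of `X` onto its quotient by the submodule generated by `T`. -/
noncomputable def quotGenπ (X : A ⥤ ModuleCat.{0} k) (T : Set (Σ a : A, X.obj a)) :
    X ⟶ quotGen X T where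
  app b := ModuleCat.ofHom (genAt X T b).mkQ
  naturality a b φ := by
    ext x
    rfl

lemma quotGenπ_surjective (X : A ⥤ ModuleCat.{0} k) (T : Set (Σ a : A, X.obj a)) (b : A) :
    Function.Surjective ((quotGenπ X T).app b).hom :=
  (genAt X T b).mkQ_surjective

lemma quotGenπ_eq_zero_iff {X : A ⥤ ModuleCat.{0} k} {T : Set (Σ a : A, X.obj a)} {b : A}
    (x : X.obj b) : ((quotGenπ X T).app b).hom x = 0 ↔ x ∈ genAt X T b :=
  Submodule.Quotient.mk_eq_zero _

/-- The morphism from `quotGen X T` induced by a morphism killing `T`. -/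
noncomputable def quotGenDesc {X Y : A ⥤ ModuleCat.{0} k} {T : Set (Σ a : A, X.obj a)}
    (η : X ⟶ Y) (h : ∀ s ∈ T, (η.app s.1).hom s.2 = 0) : quotGen X T ⟶ Y where
  app b := ModuleCat.ofHom ((genAt X T b).liftQ (η.app b).hom (genAt_le_ker η h b))
  naturality a b φ := by
    ext x
    obtain ⟨x, rfl⟩ := (genAt X T a).mkQ_surjective x
    exact app_map_apply η φ x

lemma quotGenπ_desc {X Y : A ⥤ ModuleCat.{0} k} {T : Set (Σ a : A, X.obj a)}
    (η : X ⟶ Y) (h : ∀ s ∈ T, (η.app s.1).hom s.2 = 0) :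
    quotGenπ X T ≫ quotGenDesc η h = η := by
  ext b x
  rfl

lemma genAt_mono {X : A ⥤ ModuleCat.{0} k} {T U : Set (Σ a : A, X.obj a)} (h : T ⊆ U) (b : A) :
    genAt X T b ≤ genAt X U b :=
  Submodule.span_mono fun _ ⟨s, hs, φ, e⟩ => ⟨s, h hs, φ, e⟩

lemma genAt_le_map {X Y : A ⥤ ModuleCat.{0} k} (η : X ⟶ Y) {T : Set (Σ a : A, X.obj a)}
    {U : Set (Σ a : A, Y.obj a)}
    (h : ∀ s ∈ U, ∃ t : X.obj s.1, ⟨s.1, t⟩ ∈ T ∧ (η.app s.1).hom t = s.2) (b : A) :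
    genAt Y U b ≤ (genAt X T b).map (η.app b).hom := by
  refine Submodule.span_le.2 ?_
  rintro _ ⟨s, hs, φ, rfl⟩
  obtain ⟨t, ht, e⟩ := h s hs
  exact ⟨(X.map φ).hom t, map_mem_genAt ht φ, by rw [app_map_apply, e]⟩

lemma exists_finite_lift {X Y : A ⥤ ModuleCat.{0} k} (η : X ⟶ Y)
    {U : Set (Σ a : A, Y.obj a)} (hU : U.Finite)
    (h : ∀ s ∈ U, ∃ t : X.obj s.1, (η.app s.1).hom t = s.2) :
    ∃ T : Set (Σ a : A, X.obj a), T.Finite ∧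
      (∀ s ∈ U, ∃ t : X.obj s.1, ⟨s.1, t⟩ ∈ T ∧ (η.app s.1).hom t = s.2) ∧
      ∀ t ∈ T, (⟨t.1, (η.app t.1).hom t.2⟩ : Σ a : A, Y.obj a) ∈ U := by
  choose t ht using h
  have := hU.to_subtype
  refine ⟨Set.range fun s : U => ⟨s.1.1, t s.1 s.2⟩, Set.finite_range _,
    fun s hs => ⟨t s hs, ⟨⟨s, hs⟩, rfl⟩, ht s hs⟩, ?_⟩
  rintro _ ⟨s, rfl⟩
  simp only [ht]
  exact s.2

end Functors

section Presentations

variable {k} {A : Type} [Category.{0} A] [Preadditive A] [CategoryTheory.Linear k A]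

/-- A linear functor receiving a pointwise surjection from a module is a module. -/
lemma IsMod.of_epi {X Y : A ⥤ ModuleCat.{0} k} (hX : IsMod k X) (η : X ⟶ Y)
    (hη : ∀ a, Function.Surjective (η.app a).hom) : IsMod k Y := by
  refine ⟨fun {a b} f g => ?_, fun {a b} r f => ?_⟩
  · ext y
    obtain ⟨x, rfl⟩ := hη a y
    simp only [ModuleCat.hom_add, LinearMap.add_apply, ← app_map_apply, hX.1, map_add]
  · ext y
    obtain ⟨x, rfl⟩ := hη a y
    simp only [ModuleCat.hom_smul, LinearMap.smul_apply, ← app_map_apply, hX.2, map_smul]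

lemma IsLfdMod.of_epi {X Y : A ⥤ ModuleCat.{0} k} (hX : IsLfdMod k X) (η : X ⟶ Y)
    (hη : ∀ a, Function.Surjective (η.app a).hom) : IsLfdMod k Y :=
  ⟨hX.1.of_epi η hη, fun a => by
    have := hX.2 a
    exact Module.Finite.of_surjective (η.app a).hom (hη a)⟩

lemma IsMod.of_mono {X Y : A ⥤ ModuleCat.{0} k} (hY : IsMod k Y) (η : X ⟶ Y)
    (hη : ∀ a, Function.Injective (η.app a).hom) : IsMod k X := by
  refine ⟨fun {a b} f g => ?_, fun {a b} r f => ?_⟩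
  · ext x
    apply hη b
    simp only [ModuleCat.hom_add, LinearMap.add_apply, app_map_apply, hY.1, map_add]
  · ext x
    apply hη b
    simp only [ModuleCat.hom_smul, LinearMap.smul_apply, app_map_apply, hY.2, map_smul]

lemma IsLfdMod.of_jointly_mono {E X Y : A ⥤ ModuleCat.{0} k} (hX : IsLfdMod k X)
    (hY : IsLfdMod k Y) (η : E ⟶ X) (θ : E ⟶ Y)
    (h : ∀ a (z : E.obj a), (η.app a).hom z = 0 → (θ.app a).hom z = 0 → z = 0) :
    IsLfdMod k E := by
  refine ⟨⟨fun {a b} f g => ?_, fun {a b} r f => ?_⟩, fun a => ?_⟩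
  · ext x
    rw [← sub_eq_zero]
    apply h b <;>
    simp only [ModuleCat.hom_add, LinearMap.add_apply, app_map_apply, hX.1.1, hY.1.1, map_add,
      map_sub, sub_self]
  · ext x
    rw [← sub_eq_zero]
    apply h b <;>
    simp only [ModuleCat.hom_smul, LinearMap.smul_apply, app_map_apply, hX.1.2, hY.1.2, map_smul,
      map_sub, sub_self]
  · have := hX.2 a
    have := hY.2 a
    refine Module.Finite.of_injective ((η.app a).hom.prod (θ.app a).hom) ?_
    rw [injective_iff_map_eq_zero]
    intro z hz
    exact h a z (congrArg Prod.fst hz) (congrArg Prod.snd hz)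

/-- A concrete model for the direct sum of the projective modules `P_{a i}`. -/
noncomputable def projSum {ι : Type} (a : ι → A) : A ⥤ ModuleCat.{0} k where
  obj b := ModuleCat.of k (∀ i, a i ⟶ b)
  map φ := ModuleCat.ofHom (LinearMap.pi fun i => Linear.rightComp k (a i) φ ∘ₗ LinearMap.proj i)
  map_id b := by
    ext z i
    exact Category.comp_id _
  map_comp φ ψ := by
    ext z i
    exact (Category.assoc _ _ _).symm

lemma projSum_isMod {ι : Type} (a : ι → A) : IsMod k (projSum (k := k) a) := by
  refine ⟨fun f g => ?_, fun r f => ?_⟩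
  · ext z
    funext i
    exact Preadditive.comp_add _ _ _ _ _ _
  · ext z
    funext i
    exact Linear.comp_smul _ _ _ _ _ _

lemma projSum_isLfdMod [Spectroid k A] {ι : Type} [Finite ι] (a : ι → A) :
    IsLfdMod k (projSum (k := k) a) := by
  refine ⟨projSum_isMod a, fun b => ?_⟩
  have := fun i => Spectroid.homFinite (k := k) (a i) b
  exact (inferInstance : Module.Finite k (∀ i, a i ⟶ b))

/-- The morphism `⊕ P_{a i} ⟶ X` determined by elements of the `X(a i)`. -/
noncomputable def projSumDesc {ι : Type} [Fintype ι] {a : ι → A} {X : A ⥤ ModuleCat.{0} k}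
    (hX : IsMod k X) (x : ∀ i, X.obj (a i)) : projSum (k := k) a ⟶ X where
  app b := ModuleCat.ofHom
    { toFun := fun z : ∀ i, a i ⟶ b => ∑ i, (X.map (z i)).hom (x i)
      map_add' := fun z w => by
        simp [hX.1, Finset.sum_add_distrib]
      map_smul' := fun r z => by
        simp [hX.2, Finset.smul_sum] }
  naturality b c φ := by
    ext z
    change ∑ i, (X.map (z i ≫ φ)).hom (x i) = (X.map φ).hom (∑ i, (X.map (z i)).hom (x i))
    simp [map_sum]

lemma projSumDesc_apply {ι : Type} [Fintype ι] {a : ι → A} {X : A ⥤ ModuleCat.{0} k}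
    (hX : IsMod k X) (x : ∀ i, X.obj (a i)) {b : A} (z : ∀ i, a i ⟶ b) :
    ((projSumDesc hX x).app b).hom z = ∑ i, (X.map (z i)).hom (x i) := rfl

open Classical in
/-- The canonical generators of `⊕ P_{a i}`. -/
noncomputable def projGen {ι : Type} (a : ι → A) (i : ι) :
    (projSum (k := k) a).obj (a i) :=
  (Function.update (fun j => (0 : a j ⟶ a i)) i (𝟙 (a i)) : ∀ j, a j ⟶ a i)

lemma projSumDesc_gen {ι : Type} [Fintype ι] {a : ι → A} {X : A ⥤ ModuleCat.{0} k}
    (hX : IsMod k X) (x : ∀ i, X.obj (a i)) (i : ι) :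
    ((projSumDesc hX x).app (a i)).hom (projGen a i) = x i := by
  classical
  have h0 : ∀ b c : A, X.map (0 : b ⟶ c) = 0 := fun b c => by
    simpa using hX.2 (0 : k) (0 : b ⟶ c)
  unfold projGen
  rw [projSumDesc_apply, Finset.sum_eq_single i]
  · simp
  · intro j _ hj
    simp [Function.update_of_ne hj, h0]
  · simp

lemma projGen_apply_self {ι : Type} (a : ι → A) (i : ι) :
    (projGen (k := k) a i : ∀ j, a j ⟶ a i) i = 𝟙 (a i) := by
  classical
  exact Function.update_self i (𝟙 (a i)) fun j => (0 : a j ⟶ a i)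

lemma projGen_apply_ne {ι : Type} (a : ι → A) {i j : ι} (h : j ≠ i) :
    (projGen (k := k) a i : ∀ j, a j ⟶ a i) j = 0 := by
  classical
  exact Function.update_of_ne h (𝟙 (a i)) fun j => (0 : a j ⟶ a i)

lemma projSum_eq_sum {ι : Type} [Fintype ι] (a : ι → A) {b : A}
    (z : (projSum (k := k) a).obj b) :
    z = ∑ i, ((projSum (k := k) a).map ((z : ∀ i, a i ⟶ b) i)).hom (projGen a i) := by
  funext i
  refine Eq.trans ?_ (map_sum (LinearMap.proj (R := k) (φ := fun i => (a i ⟶ b)) i) _ _).symm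
  rw [Finset.sum_eq_single i]
  · exact ((congrArg (· ≫ (z : ∀ i, a i ⟶ b) i) (projGen_apply_self (k := k) a i)).trans
      (Category.id_comp _)).symm
  · intro j _ hj
    exact (congrArg (· ≫ (z : ∀ i, a i ⟶ b) j) (projGen_apply_ne (k := k) a hj.symm)).trans
      zero_comp
  · simp

/-- The projection of `⊕ P_{a i}` onto a summand. -/
noncomputable def projSumπ {ι : Type} (a : ι → A) (i : ι) :
    projSum (k := k) a ⟶ ProjAt k (a i) where
  app b := ModuleCat.ofHom (LinearMap.proj (φ := fun i => (a i ⟶ b)) i)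
  naturality _ _ _ := rfl

open Classical in
/-- The inclusion of a summand in `⊕ P_{a i}`. -/
noncomputable def projSumι {ι : Type} (a : ι → A) (i : ι) :
    ProjAt k (a i) ⟶ projSum (k := k) a where
  app b := ModuleCat.ofHom (LinearMap.single k (fun i => (a i ⟶ b)) i)
  naturality b c φ := by
    ext z
    funext j
    exact (Pi.apply_single (fun j (w : a j ⟶ b) => w ≫ φ) (fun _ => zero_comp) i
      (z : a i ⟶ b) j).symm

/-- The bicone exhibiting `projSum a` as the direct sum of the `P_{a i}`. -/
noncomputable def projSumBicone {ι : Type} (a : ι → A) :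
    Bicone fun i => ProjAt k (a i) where
  pt := projSum a
  π := projSumπ a
  ι := projSumι a
  ι_π i j := by
    classical
    apply natTrans_ext_apply
    intro b (z : a i ⟶ b)
    by_cases h : i = j
    · subst h
      simp only [dite_true]
      exact Pi.single_eq_same (M := fun i => (a i ⟶ b)) i z
    · simp only [dif_neg h]
      exact Pi.single_eq_of_ne (M := fun i => (a i ⟶ b)) (Ne.symm h) z

/-- `projSum a` is the direct sum of the `P_{a i}`. -/
noncomputable def biproductIsoProjSum {ι : Type} [Fintype ι] (a : ι → A) :
    (⨁ fun i => ProjAt k (a i)) ≅ projSum (k := k) a :=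
  (biproduct.uniqueUpToIso _ (isBilimitOfTotal (projSumBicone a) (by
    classical
    apply natTrans_ext_apply
    intro b z
    simp only [NatTrans.app_sum, ModuleCat.hom_sum, LinearMap.sum_apply]
    exact Finset.univ_sum_single (M := fun i => (a i ⟶ b)) z))).symm

lemma isFG_of_surjective {ι : Type} [Fintype ι] {a : ι → A} {X : A ⥤ ModuleCat.{0} k}
    (p : projSum a ⟶ X) (hp : ∀ b, Function.Surjective (p.app b).hom) : IsFG k X := by
  have := (epi_iff_app_surjective p).2 hp
  let e := (Fintype.equivFin ι).symm
  exact ⟨_, a ∘ e, (biproduct.reindex e fun i => ProjAt k (a i)).hom ≫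
    (biproductIsoProjSum a).hom ≫ p, inferInstance⟩

lemma isFG_of_genAt_eq_top {X : A ⥤ ModuleCat.{0} k} (hX : IsMod k X)
    {T : Set (Σ a : A, X.obj a)} (hT : T.Finite) (h : ∀ b, genAt X T b = ⊤) : IsFG k X := by
  have := hT.fintype
  refine isFG_of_surjective (projSumDesc hX fun s : T => s.1.2) fun b => ?_
  rw [← LinearMap.range_eq_top, eq_top_iff, ← h]
  refine Submodule.span_le.2 ?_
  rintro _ ⟨s, hs, φ, rfl⟩
  refine ⟨((projSum fun s : T => s.1.1).map φ).hom (projGen (fun s : T => s.1.1) ⟨s, hs⟩), ?_⟩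
  rw [app_map_apply]
  exact congrArg _ (projSumDesc_gen hX (fun s : T => s.1.2) ⟨s, hs⟩)

lemma exists_kernel_apply {X Y : A ⥤ ModuleCat.{0} k} (hX : IsMod k X) (q : X ⟶ Y) {b : A}
    (x : X.obj b) (hx : (q.app b).hom x = 0) :
    ∃ y : (kernel q).obj b, ((kernel.ι q).app b).hom y = x := by
  let g := projSumDesc (a := fun _ : Unit => b) hX fun _ => x
  have hg : g ≫ q = 0 := by
    apply natTrans_ext_apply
    intro c z
    change (q.app c).hom ((g.app c).hom z) = 0
    rw [show (g.app c).hom z = _ from projSumDesc_apply hX _ _]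
    simp [hx]
  refine ⟨((kernel.lift q g hg).app b).hom (projGen (fun _ : Unit => b) ()), ?_⟩
  change ((kernel.lift q g hg ≫ kernel.ι q).app b).hom _ = x
  rw [kernel.lift_ι]
  exact projSumDesc_gen hX (fun _ : Unit => x) ()

/-- Finite presentation in terms of generators and relations. -/
def FinPresented (X : A ⥤ ModuleCat.{0} k) : Prop :=
  ∃ (ι : Type) (_ : Fintype ι) (a : ι → A) (p : projSum (k := k) a ⟶ X)
    (T : Set (Σ b : A, (projSum (k := k) a).obj b)), T.Finite ∧
    (∀ b, Function.Surjective (p.app b).hom) ∧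
    ∀ b (z : (projSum (k := k) a).obj b), (p.app b).hom z = 0 ↔ z ∈ genAt _ T b

lemma FinPresented.isFP {X : A ⥤ ModuleCat.{0} k} (h : FinPresented X) : IsFP k X := by
  obtain ⟨ι, _, a, p, T, hT, hp, hker⟩ := h
  have := (epi_iff_app_surjective p).2 hp
  let e := (Fintype.equivFin ι).symm
  let i : (⨁ fun i => ProjAt k ((a ∘ e) i)) ≅ projSum (k := k) a :=
    biproduct.reindex e (fun i => ProjAt k (a i)) ≪≫ biproductIsoProjSum a
  refine ⟨_, a ∘ e, i.hom ≫ p, inferInstance, ?_⟩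
  have hB : IsMod k (⨁ fun i => ProjAt k ((a ∘ e) i)) :=
    (projSum_isMod a).of_epi i.inv ((epi_iff_app_surjective _).1 inferInstance)
  let j := kernel.ι (i.hom ≫ p) ≫ i.hom
  have hj := (mono_iff_app_injective j).1 inferInstance
  obtain ⟨U, hU, hUT, -⟩ := exists_finite_lift j hT fun s hs => by
    obtain ⟨y, hy⟩ := (epi_iff_app_surjective i.hom).1 inferInstance s.1 s.2
    obtain ⟨x, hx⟩ := exists_kernel_apply hB (i.hom ≫ p) y <| by
      change (p.app _).hom ((i.hom.app _).hom y) = 0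
      rw [hy, hker]
      exact mem_genAt hs
    refine ⟨x, ?_⟩
    rw [← hy, ← hx]
    rfl
  refine isFG_of_genAt_eq_top ((projSum_isMod a).of_mono j hj) hU fun b => ?_
  rw [eq_top_iff]
  intro x _
  have hx : (j.app b).hom x ∈ genAt _ T b := by
    rw [← hker]
    change ((kernel.ι (i.hom ≫ p) ≫ i.hom ≫ p).app b).hom x = 0
    rw [kernel.condition]
    rfl
  obtain ⟨y, hy, e⟩ := genAt_le_map j hUT b hx
  rwa [← hj b e]

lemma FinPresented.isLfdMod [Spectroid k A] {X : A ⥤ ModuleCat.{0} k} (h : FinPresented X) :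
    IsLfdMod k X := by
  obtain ⟨ι, _, a, p, T, hT, hp, hker⟩ := h
  exact (projSum_isLfdMod a).of_epi p hp

/-- A quotient of a finitely presented module by finitely many elements is finitely
presented. -/
lemma FinPresented.of_surjective {X Y : A ⥤ ModuleCat.{0} k} (h : FinPresented X) (η : X ⟶ Y)
    (hη : ∀ b, Function.Surjective (η.app b).hom) {U : Set (Σ a : A, X.obj a)} (hU : U.Finite)
    (hker : ∀ b (x : X.obj b), (η.app b).hom x = 0 ↔ x ∈ genAt X U b) : FinPresented Y := by
  obtain ⟨ι, _, a, p, T, hT, hp, hpT⟩ := h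
  obtain ⟨V, hV, hVU, hUV⟩ := exists_finite_lift p hU fun s _ => hp s.1 s.2
  refine ⟨ι, ‹_›, a, p ≫ η, T ∪ V, hT.union hV, fun b => (hη b).comp (hp b), fun b z =>
    ⟨fun hz => ?_, fun hz => ?_⟩⟩
  · obtain ⟨w, hw, e⟩ := genAt_le_map p hVU b ((hker b _).1 hz)
    have h1 : z - w ∈ genAt _ T b := by
      rw [← hpT, map_sub]
      exact sub_eq_zero.2 e.symm
    rw [← sub_add_cancel z w]
    exact add_mem (genAt_mono Set.subset_union_left b h1)
      (genAt_mono Set.subset_union_right b hw)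
  · refine genAt_le_ker (p ≫ η) ?_ b hz
    rintro s (hs | hs)
    · change (η.app _).hom ((p.app _).hom s.2) = 0
      rw [(hpT _ _).2 (mem_genAt hs), map_zero]
    · exact (hker _ _).2 (mem_genAt (hUV s hs))

lemma FinPresented.of_retract {X Y : A ⥤ ModuleCat.{0} k} (h : FinPresented X) (v : X ⟶ Y)
    (i : Y ⟶ X) (hiv : i ≫ v = 𝟙 Y) : FinPresented Y := by
  obtain ⟨ι, _, a, p, T, hT, hp, hpT⟩ := id h
  have hi : ∀ b (y : Y.obj b), (v.app b).hom ((i.app b).hom y) = y := fun b y =>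
    congrArg (fun η : Y ⟶ Y => (η.app b).hom y) hiv
  let d : X ⟶ X := 𝟙 X - v ≫ i
  have hd : ∀ b (x : X.obj b), (d.app b).hom x = x - (i.app b).hom ((v.app b).hom x) :=
    fun b x => rfl
  refine h.of_surjective v (fun b y => ⟨_, hi b y⟩)
    (U := Set.range fun j => ⟨a j, (d.app _).hom ((p.app _).hom (projGen a j))⟩)
    (Set.finite_range _) fun b x => ⟨fun hx => ?_, fun hx => ?_⟩
  · have hx' : (d.app b).hom x = x := by rw [hd, hx, map_zero, sub_zero]
    obtain ⟨z, rfl⟩ := hp b x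
    rw [← hx', projSum_eq_sum a z]
    simp only [map_sum, app_map_apply]
    exact sum_mem fun j _ => map_mem_genAt (Set.mem_range_self j) _
  · refine genAt_le_ker v ?_ b hx
    rintro _ ⟨j, rfl⟩
    simp only [hd, map_sub, hi, sub_self]

end Presentations

section Pullbacks

variable {C : Type*} [Category C] [Abelian C]

lemma mono_biprod_lift_pullback {X Y Z : C} (v : X ⟶ Z) (g : Y ⟶ Z) :
    Mono (biprod.lift (pullback.fst v g) (pullback.snd v g)) := by
  refine ⟨fun a b e => pullback.hom_ext ?_ ?_⟩
  · simpa using congrArg (· ≫ biprod.fst) e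
  · simpa using congrArg (· ≫ biprod.snd) e

/-- A morphism to the cokernel of `f` lifts as soon as the pullback extension splits. -/
lemma exists_lift_of_retraction {L M X : C} (f : L ⟶ M) [Mono f] (v : X ⟶ cokernel f)
    (s : L ⟶ pullback v (cokernel.π f)) (hs1 : s ≫ pullback.fst v (cokernel.π f) = 0)
    (hs2 : s ≫ pullback.snd v (cokernel.π f) = f) (r : pullback v (cokernel.π f) ⟶ L)
    (hr : s ≫ r = 𝟙 L) : ∃ u : X ⟶ M, u ≫ cokernel.π f = v := by
  let κ := Abelian.monoLift f (kernel.ι (pullback.fst v (cokernel.π f)) ≫ pullback.snd _ _)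
    (by rw [Category.assoc, ← pullback.condition, kernel.condition_assoc, zero_comp])
  have hκ : κ ≫ s = kernel.ι (pullback.fst v (cokernel.π f)) := by
    apply pullback.hom_ext
    · rw [Category.assoc, hs1, comp_zero, kernel.condition]
    · rw [Category.assoc, hs2]
      exact Abelian.monoLift_comp _ _ _
  let t := Abelian.epiDesc (pullback.fst v (cokernel.π f)) (𝟙 _ - r ≫ s) (by
    rw [← hκ, Category.assoc, Preadditive.comp_sub, Category.comp_id, reassoc_of% hr, sub_self,
      comp_zero])
  have ht : pullback.fst v (cokernel.π f) ≫ t = 𝟙 _ - r ≫ s := Abelian.comp_epiDesc _ _ _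
  refine ⟨t ≫ pullback.snd _ _, ?_⟩
  rw [← cancel_epi (pullback.fst v (cokernel.π f)), Category.assoc, reassoc_of% ht,
    Preadditive.sub_comp, Category.id_comp, Category.assoc, reassoc_of% hs2,
    cokernel.condition, comp_zero, sub_zero,
    pullback.condition]

end Pullbacks

section LinearSystems

open Module

variable {k} {I : Type} {W : I → Type} [∀ i, AddCommGroup (W i)] [∀ i, Module k (W i)]

open Classical in
/-- The evaluation at `y` of a linear form involving finitely many coordinates. -/
noncomputable def evalForm (y : ∀ i, W i) : (Π₀ i, Dual k (W i)) →ₗ[k] k :=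
  DFinsupp.lsum ℕ fun i => Dual.eval k (W i) (y i)

open Classical in
lemma evalForm_single (y : ∀ i, W i) (i : I) (ξ : Dual k (W i)) :
    evalForm y (DFinsupp.single i ξ) = ξ (y i) := by
  simp [evalForm]

open Classical in
/-- The linear form sending `y` to `ξ (y i) - ξ' (y j) - ξ'' (y l)`. -/
noncomputable def relForm (i j l : I) (ξ : Dual k (W i)) (ξ' : Dual k (W j))
    (ξ'' : Dual k (W l)) : Π₀ i, Dual k (W i) :=
  DFinsupp.single i ξ + DFinsupp.single j (-ξ') + DFinsupp.single l (-ξ'')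

lemma evalForm_relForm (y : ∀ i, W i) (i j l : I) (ξ : Dual k (W i)) (ξ' : Dual k (W j))
    (ξ'' : Dual k (W l)) :
    evalForm y (relForm i j l ξ ξ' ξ'') = ξ (y i) - ξ' (y j) - ξ'' (y l) := by
  simp only [relForm, map_add, evalForm_single, LinearMap.neg_apply, sub_eq_add_neg]

/-- A system of linear equations over a field, each in finitely many finite-dimensional unknowns,
is solvable as soon as its finite subsystems are. -/
lemma exists_solution [∀ i, FiniteDimensional k (W i)] {J : Type}
    (e : J → (Π₀ i, Dual k (W i)) × k)
    (h : ∀ J₀ : Finset J, ∃ y : ∀ i, W i, ∀ j ∈ J₀, evalForm y (e j).1 = (e j).2) :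
    ∃ y : ∀ i, W i, ∀ j, evalForm y (e j).1 = (e j).2 := by
  classical
  have hnot : ((0, 1) : (Π₀ i, Dual k (W i)) × k) ∉ Submodule.span k (Set.range e) := by
    intro hmem
    obtain ⟨c, hc⟩ := (Finsupp.mem_span_range_iff_exists_finsupp).1 hmem
    obtain ⟨y, hy⟩ := h c.support
    let G : ((Π₀ i, Dual k (W i)) × k) →ₗ[k] k :=
      evalForm y ∘ₗ LinearMap.fst k _ _ - LinearMap.snd k _ _
    have hG : G (c.sum fun i a => a • e i) = 0 := by
      rw [map_finsuppSum]
      refine Finset.sum_eq_zero fun j hj => ?_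
      simp [G, hy j hj]
    rw [hc] at hG
    simp [G] at hG
  obtain ⟨G, hG1, hG⟩ := Submodule.exists_le_ker_of_notMem
    (p := Submodule.span k (Set.range e)) hnot
  let F : (Π₀ i, Dual k (W i)) →ₗ[k] k := -(G (0, 1))⁻¹ • (G ∘ₗ LinearMap.inl k _ _)
  let y : ∀ i, W i := fun i => (evalEquiv k (W i)).symm
    (F ∘ₗ DFinsupp.lsingle (R := k) (M := fun i => Dual k (W i)) i)
  have hy : evalForm y = F := by
    refine DFinsupp.lhom_ext fun i ξ => ?_
    rw [evalForm_single]
    change ξ ((evalEquiv k (W i)).symm _) = _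
    rw [apply_evalEquiv_symm_apply]
    rfl
  refine ⟨y, fun j => ?_⟩
  have hj : G (e j) = 0 := hG (Submodule.subset_span ⟨j, rfl⟩)
  have hs : e j = ((e j).1, 0) + (e j).2 • (0, 1) := by ext <;> simp
  rw [hs, map_add, map_smul, smul_eq_mul] at hj
  rw [hy]
  change -(G (0, 1))⁻¹ * G ((e j).1, 0) = (e j).2
  rw [eq_neg_of_add_eq_zero_left hj]
  field_simp

end LinearSystems

section Purity

open Module

variable {k} {A : Type} [Category.{0} A]

/-- The data of a linear relation `z = N(φ) x + N(ψ) x'` between elements of `N`. -/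
structure LinRel (N : A ⥤ ModuleCat.{0} k) where
  src : A
  src' : A
  tgt : A
  φ : src ⟶ tgt
  ψ : src' ⟶ tgt
  x : N.obj src
  x' : N.obj src'

/-- The element `N(φ) x + N(ψ) x'`. -/
noncomputable def LinRel.val {N : A ⥤ ModuleCat.{0} k} (r : LinRel N) : N.obj r.tgt :=
  (N.map r.φ).hom r.x + (N.map r.ψ).hom r.x'

/-- A family `y` indexed by the elements of `N` respects the relation `r`. -/
def LinRel.Respects {N M : A ⥤ ModuleCat.{0} k} (r : LinRel N)
    (y : ∀ s : (Σ a : A, N.obj a), M.obj s.1) : Prop :=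
  y ⟨r.tgt, r.val⟩ = (M.map r.φ).hom (y ⟨r.src, r.x⟩) + (M.map r.ψ).hom (y ⟨r.src', r.x'⟩)

lemma exists_respects_all {M N : A ⥤ ModuleCat.{0} k} (hM : ∀ a, FiniteDimensional k (M.obj a))
    (π : M ⟶ N)
    (h : ∀ R : Finset (LinRel N), ∃ y : ∀ s : (Σ a : A, N.obj a), M.obj s.1,
      (∀ s, (π.app s.1).hom (y s) = s.2) ∧ ∀ r ∈ R, r.Respects y) :
    ∃ y : ∀ s : (Σ a : A, N.obj a), M.obj s.1,
      (∀ s, (π.app s.1).hom (y s) = s.2) ∧ ∀ r : LinRel N, r.Respects y := by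
  classical
  let sg (s : Σ a : A, N.obj a) (ξ : Dual k (M.obj s.1)) :
      Π₀ s : (Σ a : A, N.obj a), Dual k (M.obj s.1) := DFinsupp.single s ξ
  have hsg : ∀ y s ξ, evalForm y (sg s ξ) = ξ (y s) := fun y s ξ => by
    convert evalForm_single y s ξ
  let e : (Σ r : LinRel N, Dual k (M.obj r.tgt)) ⊕
      (Σ s : (Σ a : A, N.obj a), Dual k (N.obj s.1)) →
      (Π₀ s : (Σ a : A, N.obj a), Dual k (M.obj s.1)) × k :=
    Sum.elim
      (fun j => (relForm (W := fun s : (Σ a : A, N.obj a) => M.obj s.1)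
        ⟨j.1.tgt, j.1.val⟩ ⟨j.1.src, j.1.x⟩ ⟨j.1.src', j.1.x'⟩ j.2
        (j.2 ∘ₗ (M.map j.1.φ).hom) (j.2 ∘ₗ (M.map j.1.ψ).hom), 0))
      (fun j => (sg j.1 (j.2 ∘ₗ (π.app j.1.1).hom), j.2 j.1.2))
  obtain ⟨y, hy⟩ := exists_solution e fun J₀ => by
    obtain ⟨y, hy, hR⟩ := h (J₀.toLeft.image Sigma.fst)
    refine ⟨y, ?_⟩
    rintro (j | j) hj
    · have := hR j.1 (Finset.mem_image_of_mem _ (Finset.mem_toLeft.2 hj))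
      unfold LinRel.Respects at this
      simp only [e, Sum.elim_inl, evalForm_relForm, LinearMap.comp_apply, this, map_add]
      abel
    · simp only [e, Sum.elim_inr, hsg, LinearMap.comp_apply, hy]
  refine ⟨y, fun s => ?_, fun r => ?_⟩
  · rw [← sub_eq_zero, ← forall_dual_apply_eq_zero_iff k]
    intro η
    have := hy (Sum.inr ⟨s, η⟩)
    simp only [e, Sum.elim_inr, hsg, LinearMap.comp_apply] at this
    rw [map_sub, this, sub_self]
  · unfold LinRel.Respects
    rw [← sub_eq_zero, ← forall_dual_apply_eq_zero_iff k]
    intro ξ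
    have := hy (Sum.inl ⟨r, ξ⟩)
    simp only [e, Sum.elim_inl, evalForm_relForm, LinearMap.comp_apply] at this
    rw [map_sub, map_add, ← sub_sub]
    exact this

variable [Preadditive A] [CategoryTheory.Linear k A]

/-- An epimorphism from a locally finite dimensional module along which all morphisms from
finitely presented modules lift has a section. -/
lemma exists_section_of_lifts {M N : A ⥤ ModuleCat.{0} k} (hM : IsLfdMod k M) (hN : IsMod k N)
    (π : M ⟶ N) (hπ : ∀ a, Function.Surjective (π.app a).hom)
    (h : ∀ X : A ⥤ ModuleCat.{0} k, FinPresented X → ∀ v : X ⟶ N, ∃ u : X ⟶ M, u ≫ π = v) :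
    ∃ s : N ⟶ M, s ≫ π = 𝟙 N := by
  classical
  obtain ⟨y, hy, hr⟩ := exists_respects_all hM.2 π fun R => by
    let S : Finset (Σ a : A, N.obj a) := R.biUnion fun r =>
      {⟨r.tgt, r.val⟩, ⟨r.src, r.x⟩, ⟨r.src', r.x'⟩}
    have hS : ∀ r ∈ R, (⟨r.tgt, r.val⟩ : Σ a : A, N.obj a) ∈ S ∧
        (⟨r.src, r.x⟩ : Σ a : A, N.obj a) ∈ S ∧ (⟨r.src', r.x'⟩ : Σ a : A, N.obj a) ∈ S := by
      intro r hr
      simp only [S, Finset.mem_biUnion]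
      exact ⟨⟨r, hr, by simp⟩, ⟨r, hr, by simp⟩, ⟨r, hr, by simp⟩⟩
    let P : A ⥤ ModuleCat.{0} k := projSum fun s : S => s.1.1
    let g : ∀ s : S, P.obj s.1.1 := projGen fun s : S => s.1.1
    let rel : R → Σ b : A, P.obj b := fun r => ⟨r.1.tgt,
      g ⟨_, (hS r.1 r.2).1⟩ - ((P.map r.1.φ).hom (g ⟨_, (hS r.1 r.2).2.1⟩)
        + (P.map r.1.ψ).hom (g ⟨_, (hS r.1 r.2).2.2⟩))⟩
    let T : Set (Σ b : A, P.obj b) := Set.range rel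
    let q : P ⟶ N := projSumDesc hN fun s : S => s.1.2
    have hq : ∀ s : S, (q.app s.1.1).hom (g s) = s.1.2 := fun s => projSumDesc_gen hN _ s
    have hqT : ∀ t ∈ T, (q.app t.1).hom t.2 = 0 := by
      rintro _ ⟨r, rfl⟩
      simp only [rel, map_sub, map_add, app_map_apply]
      rw [hq ⟨_, (hS r.1 r.2).1⟩, hq ⟨_, (hS r.1 r.2).2.1⟩, hq ⟨_, (hS r.1 r.2).2.2⟩]
      exact sub_self _
    have hX : FinPresented (quotGen P T) :=
      ⟨_, inferInstance, _, quotGenπ P T, T, Set.finite_range _, quotGenπ_surjective P T,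
        fun b z => quotGenπ_eq_zero_iff z⟩
    obtain ⟨u, hu⟩ := h _ hX (quotGenDesc q hqT)
    let w : P ⟶ M := quotGenπ P T ≫ u
    have hw : w ≫ π = q := by rw [Category.assoc, hu, quotGenπ_desc]
    have hwT : ∀ t ∈ T, (w.app t.1).hom t.2 = 0 := fun t ht => by
      change (u.app _).hom (((quotGenπ P T).app _).hom t.2) = 0
      rw [(quotGenπ_eq_zero_iff _).2 (mem_genAt ht), map_zero]
    let y : ∀ s : (Σ a : A, N.obj a), M.obj s.1 := fun s =>
      if hs : s ∈ S then (w.app s.1).hom (g ⟨s, hs⟩) else (hπ s.1 s.2).choose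
    have hyS : ∀ s (hs : s ∈ S), y s = (w.app s.1).hom (g ⟨s, hs⟩) := fun s hs => dif_pos hs
    refine ⟨y, fun s => ?_, fun r hr => ?_⟩
    · by_cases hs : s ∈ S
      · rw [hyS s hs, ← hq ⟨s, hs⟩, ← hw]
        rfl
      · simp only [y, dif_neg hs]
        exact (hπ s.1 s.2).choose_spec
    · unfold LinRel.Respects
      rw [hyS _ (hS r hr).1, hyS _ (hS r hr).2.1, hyS _ (hS r hr).2.2]
      have := hwT _ ⟨⟨r, hr⟩, rfl⟩
      simp only [rel, map_sub, map_add, app_map_apply] at this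
      exact sub_eq_zero.1 this
  have hr0 : ∀ {b c : A}, M.map (0 : b ⟶ c) = 0 := fun {b c} => by
    simpa using hM.1.2 (0 : k) (0 : b ⟶ c)
  have hrel : ∀ (r : LinRel N) z, r.val = z → y ⟨r.tgt, z⟩ =
      (M.map r.φ).hom (y ⟨r.src, r.x⟩) + (M.map r.ψ).hom (y ⟨r.src', r.x'⟩) := by
    rintro r _ rfl
    exact hr r
  have hadd : ∀ a (x x' : N.obj a), y ⟨a, x + x'⟩ = y ⟨a, x⟩ + y ⟨a, x'⟩ := fun a x x' => by
    simpa using hrel ⟨a, a, a, 𝟙 a, 𝟙 a, x, x'⟩ (x + x') (by simp [LinRel.val])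
  have hzero : ∀ a, y ⟨a, 0⟩ = 0 := fun a => by
    simpa [hr0] using hrel ⟨a, a, a, 0, 0, 0, 0⟩ 0 (by simp [LinRel.val])
  have hmap : ∀ {a b : A} (φ : a ⟶ b) (x : N.obj a) z, (N.map φ).hom x = z →
      y ⟨b, z⟩ = (M.map φ).hom (y ⟨a, x⟩) := fun {a b} φ x z hz => by
    simpa [hzero] using hrel ⟨a, a, b, φ, φ, x, 0⟩ z (by simp [LinRel.val, hz])
  refine ⟨{ app := fun a => ModuleCat.ofHom
              { toFun := fun x => y ⟨a, x⟩
                map_add' := hadd a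
                map_smul' := fun c x => ?_ }
            naturality := fun a b φ => ?_ }, ?_⟩
  · simpa [hM.1.2] using hmap (c • 𝟙 a) x (c • x) (by simp [hN.2])
  · ext x
    exact hmap φ x _ rfl
  · apply natTrans_ext_apply
    intro a x
    exact hy ⟨a, x⟩

/-- Morphisms from a module `X` to the cokernel of an irreducible monomorphism either lift or
are factors of the cokernel projection. -/
lemma Irred.lift_or_factor {L M X : A ⥤ ModuleCat.{0} k} {f : L ⟶ M} [Mono f] (hf : Irred k f)
    (hM : IsLfdMod k M) (hX : IsLfdMod k X) (v : X ⟶ cokernel f) :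
    (∃ u : X ⟶ M, u ≫ cokernel.π f = v) ∨ ∃ w : M ⟶ X, w ≫ v = cokernel.π f := by
  have hE : IsLfdMod k (pullback v (cokernel.π f)) := by
    refine hX.of_jointly_mono hM (pullback.fst _ _) (pullback.snd _ _) fun a z h1 h2 => ?_
    apply (mono_iff_app_injective _).1
      (mono_biprod_lift_pullback v (cokernel.π f)) a
    rw [map_zero, biprod.lift_eq]
    change ((biprod.inl : X ⟶ X ⊞ M).app a).hom (((pullback.fst v (cokernel.π f)).app a).hom z) +
      ((biprod.inr : M ⟶ X ⊞ M).app a).hom (((pullback.snd v (cokernel.π f)).app a).hom z) = 0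
    rw [h1, h2, map_zero, map_zero, add_zero]
  let s : L ⟶ pullback v (cokernel.π f) := pullback.lift 0 f (by simp)
  have hs1 : s ≫ pullback.fst v (cokernel.π f) = 0 := pullback.lift_fst _ _ _
  have hs2 : s ≫ pullback.snd v (cokernel.π f) = f := pullback.lift_snd _ _ _
  rcases hf.2.2 hE s (pullback.snd _ _) hs2 with h | h
  · left
    obtain ⟨⟨r, hr⟩⟩ := h
    exact exists_lift_of_retraction f v s hs1 hs2 r hr
  · right
    obtain ⟨⟨σ, hσ⟩⟩ := h
    exact ⟨σ ≫ pullback.fst _ _, by rw [Category.assoc, pullback.condition, reassoc_of% hσ]⟩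

end Purity

variable (k : Type) [Field k] [IsAlgClosed k]
variable (A : Type) [Category.{0} A] [Preadditive A] [CategoryTheory.Linear k A]

/-- If `f : L ⟶ M` is an irreducible monomorphism in `mod A` and the canonical morphism
`M ⟶ coker f` is also irreducible, then `coker f` is finitely presented. -/
theorem statement_6 [Spectroid k A] {L M : A ⥤ ModuleCat.{0} k}
    (hL : IsLfdMod k L) (hM : IsLfdMod k M) (f : L ⟶ M) (hmono : Mono f)
    (hirr : Irred k f) (hπ : Irred k (cokernel.π f)) :
    IsFP k (cokernel f) := by
  have hsurj := (epi_iff_app_surjective (cokernel.π f)).1 inferInstance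
  have hinj := (mono_iff_app_injective f).1 hmono
  have hlift : ¬ ∀ X : A ⥤ ModuleCat.{0} k, FinPresented X →
      ∀ v : X ⟶ cokernel f, ∃ u : X ⟶ M, u ≫ cokernel.π f = v := fun h => by
    obtain ⟨s, hs⟩ := exists_section_of_lifts hM (hM.1.of_epi _ hsurj) _ hsurj h
    exact hπ.2.1 ⟨⟨s, hs⟩⟩
  push Not at hlift
  obtain ⟨X, hX, v, hv⟩ := hlift
  obtain ⟨w, hw⟩ := (hirr.lift_or_factor hM hX.isLfdMod v).resolve_left fun ⟨u, hu⟩ => hv u hu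
  apply FinPresented.isFP
  rcases hπ.2.2 hX.isLfdMod w v hw with ⟨⟨r, hr⟩⟩ | ⟨⟨i, hi⟩⟩
  · have hMfp : FinPresented M := hX.of_retract r w hr
    obtain ⟨a, l, hl⟩ : ∃ a, ∃ l : L.obj a, l ≠ 0 := by
      by_contra! hzero
      refine hirr.1 ⟨⟨0, natTrans_ext_apply fun a x => ?_⟩⟩
      rw [hzero a x, map_zero, map_zero]
    let U : Set (Σ a : A, M.obj a) := {⟨a, (f.app a).hom l⟩}
    have hfU : ∀ s ∈ U, ((cokernel.π f).app s.1).hom s.2 = 0 := by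
      rintro _ rfl
      exact congrArg (fun η : L ⟶ cokernel f => (η.app a).hom l) (cokernel.condition f)
    have hQ := quotGenπ_surjective M U
    rcases hπ.2.2 (hM.of_epi _ hQ) _ _ (quotGenπ_desc _ hfU) with h | ⟨⟨i, hi⟩⟩
    · refine absurd ?_ hl
      apply hinj a
      apply (mono_iff_app_injective (quotGenπ M U)).1 inferInstance a
      rw [map_zero, map_zero, quotGenπ_eq_zero_iff]
      exact mem_genAt (Set.mem_singleton _)
    · exact (hMfp.of_surjective _ hQ (Set.finite_singleton _)
        fun b x => quotGenπ_eq_zero_iff x).of_retract _ i hi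
  · exact hX.of_retract v i hi

end Paper
end

section
/- Let k be an algebraically closed field and A a spectroid over k. If f : M → N is an irreducible epimorphism in mod A, then the kernel ker(f) of f is finitely co-generated. -/
open CategoryTheory CategoryTheory.Limits

namespace Paper

variable (k : Type) [Field k]

section LinearCompactness

/-- A linear form with prescribed values on a family of vectors exists as soon as it does for
each finite subfamily. -/
theorem exists_dual_of_finite_subfamilies {J V : Type} [AddCommGroup V] [Module k V]
    (r : J → V) (c : J → k)
    (h : ∀ T : Finset J, ∃ ψ : Module.Dual k V, ∀ j ∈ T, ψ (r j) = c j) :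
    ∃ ψ : Module.Dual k V, ∀ j, ψ (r j) = c j := by
  let v : J → V × k := fun j => (r j, -c j)
  have hnot : ((0, 1) : V × k) ∉ Submodule.span k (Set.range v) := by
    intro hmem
    obtain ⟨l, hl⟩ := Finsupp.mem_span_range_iff_exists_finsupp.1 hmem
    obtain ⟨ψ, hψ⟩ := h l.support
    have h2 := congrArg (ψ.coprod LinearMap.id) hl
    rw [Finsupp.sum, map_sum, Finset.sum_eq_zero] at h2
    · simp at h2
    · intro j hj
      simp [v, hψ j hj]
  obtain ⟨φ, hφ, hle⟩ := Submodule.exists_le_ker_of_notMem hnot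
  refine ⟨(φ (0, 1))⁻¹ • φ.comp (LinearMap.inl k V k), fun j => ?_⟩
  have h1 : φ (v j) = 0 := hle (Submodule.subset_span ⟨j, rfl⟩)
  have h2 : v j = (r j, 0) - c j • ((0, 1) : V × k) := by simp [v]
  rw [h2, map_sub, map_smul, sub_eq_zero, smul_eq_mul] at h1
  simp only [LinearMap.smul_apply, LinearMap.comp_apply, LinearMap.inl_apply, h1, smul_eq_mul]
  field_simp

/-- The functional on `⨁ a, Dual (W a)` given by evaluation at a family `w` of vectors. -/
noncomputable def evalFamily {ι : Type} [DecidableEq ι] {W : ι → Type}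
    [∀ a, AddCommGroup (W a)] [∀ a, Module k (W a)] (w : ∀ a, W a) :
    (DirectSum ι fun a => Module.Dual k (W a)) →ₗ[k] k :=
  DirectSum.toModule k ι k fun a => Module.Dual.eval k (W a) (w a)

/-- A system of linear equations, each involving finitely many unknowns taken from
finite-dimensional spaces, is solvable as soon as its finite subsystems are. -/
theorem exists_solution_of_finite_subsystems {ι J : Type} [DecidableEq ι] {W : ι → Type}
    [∀ a, AddCommGroup (W a)] [∀ a, Module k (W a)] [∀ a, FiniteDimensional k (W a)]
    (r : J → DirectSum ι fun a => Module.Dual k (W a)) (c : J → k)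
    (h : ∀ T : Finset J, ∃ w : ∀ a, W a, ∀ j ∈ T, evalFamily k w (r j) = c j) :
    ∃ w : ∀ a, W a, ∀ j, evalFamily k w (r j) = c j := by
  obtain ⟨ψ, hψ⟩ := exists_dual_of_finite_subfamilies k r c fun T =>
    (h T).imp' (evalFamily k) fun _ hw => hw
  refine ⟨fun a => (Module.evalEquiv k (W a)).symm
      (ψ.comp (DirectSum.lof k ι (fun a => Module.Dual k (W a)) a)),
    fun j => Eq.trans (LinearMap.congr_fun ?_ (r j)) (hψ j)⟩
  refine DirectSum.linearMap_ext k fun a => ?_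
  ext μ
  simp [evalFamily]

end LinearCompactness

section KernelQuotient

variable {A : Type} [Category.{0} A]
variable {M N : A ⥤ ModuleCat.{0} k}

/-- The elements of `ker f` at `b` annihilated by all morphisms from `b` to objects in `F`. -/
def kerVanishing (f : M ⟶ N) (F : Finset A) (b : A) : Submodule k (M.obj b) :=
  LinearMap.ker (f.app b).hom ⊓ ⨅ a ∈ F, ⨅ g : b ⟶ a, LinearMap.ker (M.map g).hom

variable {k}

theorem mem_kerVanishing (f : M ⟶ N) (F : Finset A) (b : A) (x : M.obj b) :
    x ∈ kerVanishing k f F b ↔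
      (f.app b).hom x = 0 ∧ ∀ a ∈ F, ∀ g : b ⟶ a, (M.map g).hom x = 0 := by
  simp [kerVanishing, Submodule.mem_iInf]

theorem kerVanishing_le_comap (f : M ⟶ N) (F : Finset A) {b c : A} (g : b ⟶ c) :
    kerVanishing k f F b ≤ (kerVanishing k f F c).comap (M.map g).hom := by
  intro x hx
  rw [mem_kerVanishing] at hx
  rw [Submodule.mem_comap, mem_kerVanishing]
  refine ⟨?_, fun a ha h => ?_⟩
  · have := NatTrans.naturality_apply f g x
    exact this.trans (by rw [show f.app b x = 0 from hx.1, map_zero])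
  · have := hx.2 a ha (g ≫ h)
    simpa using this

theorem kerVanishing_eq_bot (f : M ⟶ N) {F : Finset A} {a : A} (ha : a ∈ F) :
    kerVanishing k f F a = ⊥ := by
  rw [eq_bot_iff]
  intro x hx
  simpa using ((mem_kerVanishing f F a x).1 hx).2 a ha (𝟙 a)

/-- The quotient of `M` by the submodule `kerVanishing`. -/
noncomputable def kerQuotient (f : M ⟶ N) (F : Finset A) : A ⥤ ModuleCat.{0} k where
  obj b := ModuleCat.of k (M.obj b ⧸ kerVanishing k f F b)
  map g := ModuleCat.ofHom (Submodule.mapQ _ _ (M.map g).hom (kerVanishing_le_comap f F g))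
  map_id b := by
    refine ModuleCat.hom_ext (Submodule.linearMap_qext _ (LinearMap.ext fun x => ?_))
    simp
  map_comp g h := by
    refine ModuleCat.hom_ext (Submodule.linearMap_qext _ (LinearMap.ext fun x => ?_))
    simp

/-- The projection of `M` onto `kerQuotient`. -/
noncomputable def kerQuotientπ (f : M ⟶ N) (F : Finset A) : M ⟶ kerQuotient f F where
  app b := ModuleCat.ofHom (kerVanishing k f F b).mkQ
  naturality b c g := by
    ext x
    rfl

/-- The map from `kerQuotient` to `N` induced by `f`. -/
noncomputable def kerQuotientDesc (f : M ⟶ N) (F : Finset A) : kerQuotient f F ⟶ N where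
  app b := ModuleCat.ofHom ((kerVanishing k f F b).liftQ (f.app b).hom inf_le_left)
  naturality b c g := by
    refine ModuleCat.hom_ext (Submodule.linearMap_qext _ (LinearMap.ext fun x => ?_))
    exact NatTrans.naturality_apply f g x

theorem kerQuotientπ_desc (f : M ⟶ N) (F : Finset A) :
    kerQuotientπ f F ≫ kerQuotientDesc f F = f := by
  ext b x
  rfl

variable [Preadditive A] [CategoryTheory.Linear k A]

theorem isLfdMod_kerQuotient (hM : IsLfdMod k M) (f : M ⟶ N) (F : Finset A) :
    IsLfdMod k (kerQuotient f F) := by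
  refine ⟨⟨fun g h => ?_, fun r g => ?_⟩, fun a => ?_⟩
  · refine ModuleCat.hom_ext (Submodule.linearMap_qext _ (LinearMap.ext fun x => ?_))
    exact congrArg (Submodule.Quotient.mk (p := kerVanishing k f F _))
      (ConcreteCategory.congr_hom (hM.1.1 g h) x)
  · refine ModuleCat.hom_ext (Submodule.linearMap_qext _ (LinearMap.ext fun x => ?_))
    exact congrArg (Submodule.Quotient.mk (p := kerVanishing k f F _))
      (ConcreteCategory.congr_hom (hM.1.2 r g) x)
  · have := hM.2 a
    exact inferInstanceAs (FiniteDimensional k (M.obj a ⧸ kerVanishing k f F a))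

/-- The morphism `M ⟶ I_a` corresponding to a linear form on `M a`. -/
noncomputable def toInjAt (hM : IsMod k M) (a : A) (μ : Module.Dual k (M.obj a)) :
    M ⟶ InjAt k a where
  app b := ModuleCat.ofHom
    (LinearMap.mk₂ k (fun (x : M.obj b) (g : b ⟶ a) => μ ((M.map g).hom x))
      (fun _ _ _ => by simp) (fun _ _ _ => by simp)
      (fun _ _ _ => by simp [hM.1]) (fun _ _ _ => by simp [hM.2]))
  naturality b c g := by
    ext x
    refine LinearMap.ext fun h => ?_
    have h1 : (M.map (g ≫ h)).hom x = (M.map h).hom ((M.map g).hom x) := by simp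
    exact congrArg μ h1.symm

theorem isFCG_kernel_of_kerVanishing_eq_bot (hM : IsLfdMod k M) (f : M ⟶ N) (F : Finset A)
    (h : ∀ b, kerVanishing k f F b = ⊥) : IsFCG k (kernel f) := by
  have := hM.2
  let J := Σ a : F, Fin (Module.finrank k (M.obj a))
  let e : Fin (Fintype.card J) ≃ J := (Fintype.equivFin J).symm
  let φ : ∀ j : J, M ⟶ InjAt k (j.1 : A) := fun j =>
    toInjAt hM.1 j.1 ((Module.finBasis k (M.obj j.1)).coord j.2)
  let Φ := biproduct.lift fun i => kernel.ι f ≫ φ (e i)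
  refine ⟨Fintype.card J, fun i => ((e i).1 : A), Φ, ?_⟩
  rw [NatTrans.mono_iff_mono_app]
  intro b
  rw [ModuleCat.mono_iff_injective, injective_iff_map_eq_zero]
  intro x hx
  have hι : Function.Injective ((kernel.ι f).app b) :=
    (ModuleCat.mono_iff_injective _).1 inferInstance
  refine hι (Eq.trans ?_ (map_zero _).symm)
  rw [← Submodule.mem_bot k, ← h b, mem_kerVanishing]
  constructor
  · exact ConcreteCategory.congr_hom (NatTrans.congr_app (kernel.condition f) b) x
  · intro a ha g
    refine (Module.finBasis k (M.obj a)).ext_elem_iff.2 fun i => ?_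
    have h1 : Φ ≫ biproduct.π _ (e.symm ⟨⟨a, ha⟩, i⟩) = _ := biproduct.lift_π _ _
    have h2 := ConcreteCategory.congr_hom (NatTrans.congr_app h1 b) x
    rw [NatTrans.comp_app, ConcreteCategory.comp_apply, hx, map_zero] at h2
    have h3 : ((φ (e (e.symm ⟨⟨a, ha⟩, i⟩))).app b).hom ((kernel.ι f).app b x) = 0 := h2.symm
    rw [e.apply_symm_apply] at h3
    have h4 := LinearMap.congr_fun (show _ = (0 : Module.Dual k (b ⟶ a)) from h3) g
    exact h4.trans (by simp)

end KernelQuotient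

section LocalSections

variable {A : Type} [Category.{0} A] {M N : A ⥤ ModuleCat.{0} k}

variable {k}

/-- An epimorphism of locally finite-dimensional functors splits if over every finite set of
objects it has a pointwise section natural for the morphisms ending in that set. -/
theorem isSplitEpi_of_local_sections (hM : ∀ a, FiniteDimensional k (M.obj a))
    (hN : ∀ a, FiniteDimensional k (N.obj a)) (f : M ⟶ N)
    (h : ∀ F : Finset A, ∃ w : ∀ a, N.obj a →ₗ[k] M.obj a,
      (∀ a x, (f.app a).hom (w a x) = x) ∧
      ∀ a, ∀ b ∈ F, ∀ (g : a ⟶ b) x, (M.map g).hom (w a x) = w b ((N.map g).hom x)) :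
    IsSplitEpi f := by
  classical
  let J₁ := Σ a : A, Σ b : A, (a ⟶ b) × N.obj a × Module.Dual k (M.obj b)
  let J₂ := Σ a : A, N.obj a × Module.Dual k (N.obj a)
  let W : A → Type := fun a => N.obj a →ₗ[k] M.obj a
  let D := DirectSum A fun a => Module.Dual k (W a)
  let r₁ : J₁ → D := fun ⟨a, b, g, x, μ⟩ =>
    DirectSum.lof k A (fun a => Module.Dual k (W a)) a
        ((μ ∘ₗ (M.map g).hom) ∘ₗ LinearMap.applyₗ x) -
      DirectSum.lof k A (fun a => Module.Dual k (W a)) b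
        (μ ∘ₗ LinearMap.applyₗ ((N.map g).hom x))
  let r₂ : J₂ → D := fun ⟨a, x, μ⟩ =>
    DirectSum.lof k A (fun a => Module.Dual k (W a)) a
      ((μ ∘ₗ (f.app a).hom) ∘ₗ LinearMap.applyₗ x)
  have e₁ : ∀ (w : ∀ a, W a) (j : J₁), evalFamily k w (r₁ j) =
      j.2.2.2.2 ((M.map j.2.2.1).hom (w j.1 j.2.2.2.1)) -
        j.2.2.2.2 (w j.2.1 ((N.map j.2.2.1).hom j.2.2.2.1)) := by
    rintro w ⟨a, b, g, x, μ⟩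
    simp [r₁, evalFamily]
    rfl
  have e₂ : ∀ (w : ∀ a, W a) (j : J₂), evalFamily k w (r₂ j) =
      j.2.2 ((f.app j.1).hom (w j.1 j.2.1)) := by
    rintro w ⟨a, x, μ⟩
    simp [r₂, evalFamily]
    rfl
  obtain ⟨w, hw⟩ := exists_solution_of_finite_subsystems k (W := W) (Sum.elim r₁ r₂)
    (Sum.elim (fun _ => 0) fun j => j.2.2 j.2.1) (by
      intro T
      obtain ⟨w, hw, hnat⟩ := h (T.toLeft.image fun j => j.2.1)
      refine ⟨w, ?_⟩
      rintro (j | j) hj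
      · have := hnat j.1 j.2.1
          (Finset.mem_image_of_mem (fun j : J₁ => j.2.1) (Finset.mem_toLeft.2 hj))
          j.2.2.1 j.2.2.2.1
        simp [e₁, this]
      · simp [e₂, hw])
  have hnat : ∀ a b (g : a ⟶ b) x, (M.map g).hom (w a x) = w b ((N.map g).hom x) := by
    intro a b g x
    rw [← sub_eq_zero, ← Module.forall_dual_apply_eq_zero_iff k]
    intro μ
    have := hw (Sum.inl ⟨a, b, g, x, μ⟩)
    rw [map_sub]
    exact (e₁ w ⟨a, b, g, x, μ⟩).symm.trans this
  have hsec : ∀ a x, (f.app a).hom (w a x) = x := by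
    intro a x
    rw [← sub_eq_zero, ← Module.forall_dual_apply_eq_zero_iff k]
    intro μ
    have := hw (Sum.inr ⟨a, x, μ⟩)
    rw [map_sub]
    exact sub_eq_zero.2 ((e₂ w ⟨a, x, μ⟩).symm.trans this)
  refine ⟨⟨⟨{ app := fun a => ModuleCat.ofHom (w a), naturality := ?_ }, ?_⟩⟩⟩
  · intro a b g
    ext x
    exact (hnat a b g x).symm
  · ext a x
    exact hsec a x

end LocalSections

variable (k : Type) [Field k] [IsAlgClosed k]
variable (A : Type) [Category.{0} A] [Preadditive A] [CategoryTheory.Linear k A]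

/-- An irreducible epimorphism in `mod A` has finitely co-generated kernel. -/
theorem statement_8 [Spectroid k A] {M N : A ⥤ ModuleCat.{0} k}
    (hM : IsLfdMod k M) (hN : IsLfdMod k N) (f : M ⟶ N) (hepi : Epi f)
    (hirr : Irred k f) :
    IsFCG k (kernel f) := by
  by_contra hK
  refine hirr.2.1 (isSplitEpi_of_local_sections hM.2 hN.2 f fun F => ?_)
  rcases hirr.2.2 (isLfdMod_kerQuotient hM f F) _ _ (kerQuotientπ_desc f F) with hs | hs
  · refine absurd (isFCG_kernel_of_kerVanishing_eq_bot hM f F fun b => ?_) hK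
    have hinj : Function.Injective ((kerQuotientπ f F).app b) :=
      (ModuleCat.mono_iff_injective _).1 inferInstance
    exact (Submodule.ker_mkQ _).symm.trans (LinearMap.ker_eq_bot.2 hinj)
  · let s := section_ (kerQuotientDesc f F)
    have hlift : ∀ a, ∃ w : N.obj a →ₗ[k] M.obj a,
        (kerVanishing k f F a).mkQ ∘ₗ w = (s.app a).hom := fun a =>
      Module.projective_lifting_property _ _ (Submodule.mkQ_surjective _)
    choose w hw using hlift
    have hw' : ∀ a x, ((kerQuotientπ f F).app a).hom (w a x) = (s.app a).hom x :=
      fun a x => LinearMap.congr_fun (hw a) x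
    refine ⟨w, fun a x => ?_, fun a b hb g x => ?_⟩
    · have h1 := ConcreteCategory.congr_hom
        (NatTrans.congr_app (kerQuotientπ_desc f F) a) (w a x)
      have h2 := ConcreteCategory.congr_hom
        (NatTrans.congr_app (IsSplitEpi.id (kerQuotientDesc f F)) a) x
      refine h1.symm.trans (Eq.trans ?_ h2)
      exact congrArg ((kerQuotientDesc f F).app a).hom (hw' a x)
    · have hinj : Function.Injective (kerVanishing k f F b).mkQ := by
        rw [← LinearMap.ker_eq_bot, Submodule.ker_mkQ, kerVanishing_eq_bot f hb]
      apply hinj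
      have h1 := NatTrans.naturality_apply (kerQuotientπ f F) g (w a x)
      have h2 := NatTrans.naturality_apply s g x
      refine h1.trans (Eq.trans ?_ (h2.symm.trans (hw' b _).symm))
      exact congrArg ((kerQuotient f F).map g).hom (hw' a x)

end Paper
end
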